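/- Let l ≥ 1 and e ≥ 2 be integers and let s = (s_1,…,s_l) ∈ ℤ^l satisfy s_1 ≤ s_2 ≤ … ≤ s_l and s_l − s_1 ≥ e. Let s' be the weakly increasing rearrangement of ξ(s) = (s_l − e, s_1, …, s_{l−1}). Then s'_1 = s_1 and ‖s'‖ = ‖s‖ − e, where ‖t‖ := Σ_{k=2}^{l} (t_k − t_1) for t ∈ ℤ^l. -/

import Mathlib

namespace FockCrystal

/-- The cyclage on multicharges: `ξ(s) = (s_l − e, s_1, …, s_{l−1})`. -/
def xiCharge (l e : ℕ) (s : Fin (l + 1) → ℤ) : Fin (l + 1) → ℤ :=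
  fun c => s ((finRotate (l + 1)).symm c) - if c = 0 then (e : ℤ) else 0

theorem xiCharge_finRotate (l e : ℕ) (s : Fin (l + 1) → ℤ) (c : Fin (l + 1)) :
    xiCharge l e s (finRotate (l + 1) c) =
      s c - if finRotate (l + 1) c = 0 then (e : ℤ) else 0 := by
  simp [xiCharge]

theorem xiCharge_zero (l e : ℕ) (s : Fin (l + 1) → ℤ) :
    xiCharge l e s 0 = s (Fin.last l) - e := by
  have h := xiCharge_finRotate l e s (Fin.last l)
  simpa only [finRotate_last, if_true] using h

theorem sum_xiCharge (l e : ℕ) (s : Fin (l + 1) → ℤ) :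
    ∑ c, xiCharge l e s c = ∑ c, s c - e := by
  simp only [xiCharge, Finset.sum_sub_distrib, Equiv.sum_comp (finRotate (l + 1)).symm s,
    Finset.sum_ite_eq', Finset.mem_univ, if_true]

theorem le_xiCharge {l e : ℕ} {s : Fin (l + 1) → ℤ} (hmono : Monotone s)
    (hgap : (e : ℤ) ≤ s (Fin.last l) - s 0) (c : Fin (l + 1)) :
    s 0 ≤ xiCharge l e s c := by
  by_cases hc : c = 0
  · rw [hc, xiCharge_zero]
    linarith
  · simpa [xiCharge, hc] using hmono (Fin.zero_le _)

theorem exists_xiCharge_le (l e : ℕ) (s : Fin (l + 1) → ℤ) :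
    ∃ c, xiCharge l e s c ≤ s 0 := by
  refine ⟨finRotate (l + 1) 0, ?_⟩
  rw [xiCharge_finRotate]
  split_ifs <;> omega

/-!
STATEMENT 2: if s_1 ≤ … ≤ s_l and s_l − s_1 ≥ e, and s' is the weakly increasing
rearrangement of ξ(s) = (s_l − e, s_1, …, s_{l−1}), then s'_1 = s_1 and
‖s'‖ = ‖s‖ − e, where ‖t‖ = Σ_k (t_k − t_1).
-/
theorem norm_decreases_after_cyclage_and_sorting
    (l e : ℕ) (he : 2 ≤ e) (s : Fin (l + 1) → ℤ)
    (hmono : Monotone s) (hgap : (e : ℤ) ≤ s (Fin.last l) - s 0)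
    (s' : Fin (l + 1) → ℤ) (π : Equiv.Perm (Fin (l + 1)))
    (hperm : ∀ c, s' c = xiCharge l e s (π c)) (hmono' : Monotone s') :
    s' 0 = s 0 ∧
      (∑ k : Fin (l + 1), (s' k - s' 0)) = (∑ k : Fin (l + 1), (s k - s 0)) - e := by
  have hmin : s' 0 = s 0 := by
    apply le_antisymm
    · obtain ⟨c, hc⟩ := exists_xiCharge_le l e s
      calc s' 0 ≤ s' (π.symm c) := hmono' (Fin.zero_le _)
        _ = xiCharge l e s c := by rw [hperm, Equiv.apply_symm_apply]
        _ ≤ s 0 := hc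
    · rw [hperm]
      exact le_xiCharge hmono hgap _
  have hsum : ∑ k, s' k = ∑ k, s k - e := by
    rw [← sum_xiCharge, ← Equiv.sum_comp π (xiCharge l e s)]
    exact Finset.sum_congr rfl fun c _ => hperm c
  refine ⟨hmin, ?_⟩
  rw [Finset.sum_sub_distrib, Finset.sum_sub_distrib, hsum, hmin]
  ring

end FockCrystal
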